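/- Let û, Φ : ℝ × ℝ → ℝ be smooth functions of (x,t) solving the Gurevich-Zybin system û_t + û·û_x + Φ_x = 0 and ρ_t + ∂_x(û·ρ) = 0 where ρ = Φ_xx, and assume ρ is nowhere zero. Define ᾱ₁ = (û_x² + 2ρ)·ρ^{−2}, β̄₁ = û_x·ρ^{−1}, and recursively ᾱ_{k+1} = ρ^{−1}·∂_x ᾱ_k, β̄_{k+1} = ρ^{−1}·∂_x β̄_k for k ≥ 1. Then for any n ≥ 1 and any smooth function G : ℝ^{2n−1} → ℝ, the function F = ρ·G(ᾱ₁, ᾱ₂, β̄₂, …, ᾱ_n, β̄_n) satisfies the conservation law ∂_t F = ∂_x(−û·F) at every point. -/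

import Mathlib

/-- Partial derivative with respect to the first variable `x`. -/
noncomputable def pdx (f : ℝ × ℝ → ℝ) (p : ℝ × ℝ) : ℝ := deriv (fun x => f (x, p.2)) p.1

/-- Partial derivative with respect to the second variable `t`. -/
noncomputable def pdt (f : ℝ × ℝ → ℝ) (p : ℝ × ℝ) : ℝ := deriv (fun t => f (p.1, t)) p.2

open scoped ContDiff

theorem hasDerivAt_pdx {f : ℝ × ℝ → ℝ} (hf : ContDiff ℝ ∞ f) (p : ℝ × ℝ) :
    HasDerivAt (fun x => f (x, p.2)) (pdx f p) p.1 :=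
  ((hf.differentiable (by simp)).comp
    (differentiable_id.prodMk (differentiable_const p.2)) p.1).hasDerivAt

theorem hasDerivAt_pdt {f : ℝ × ℝ → ℝ} (hf : ContDiff ℝ ∞ f) (p : ℝ × ℝ) :
    HasDerivAt (fun t => f (p.1, t)) (pdt f p) p.2 :=
  ((hf.differentiable (by simp)).comp
    ((differentiable_const p.1).prodMk differentiable_id) p.2).hasDerivAt

theorem pdx_eq_fderiv {f : ℝ × ℝ → ℝ} (hf : ContDiff ℝ ∞ f) (p : ℝ × ℝ) :
    pdx f p = fderiv ℝ f p (1, 0) :=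
  (((hf.differentiable (by simp) p).hasFDerivAt).comp_hasDerivAt (f := fun x => (x, p.2)) p.1
    ((hasDerivAt_id p.1).prodMk (hasDerivAt_const p.1 p.2))).deriv

theorem pdt_eq_fderiv {f : ℝ × ℝ → ℝ} (hf : ContDiff ℝ ∞ f) (p : ℝ × ℝ) :
    pdt f p = fderiv ℝ f p (0, 1) :=
  (((hf.differentiable (by simp) p).hasFDerivAt).comp_hasDerivAt (f := fun t => (p.1, t)) p.2
    ((hasDerivAt_const p.2 p.1).prodMk (hasDerivAt_id p.2))).deriv

theorem contDiff_pdx {f : ℝ × ℝ → ℝ} (hf : ContDiff ℝ ∞ f) : ContDiff ℝ ∞ (pdx f) := by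
  rw [funext (pdx_eq_fderiv hf)]
  exact (hf.fderiv_right (by simp)).clm_apply contDiff_const

theorem contDiff_pdt {f : ℝ × ℝ → ℝ} (hf : ContDiff ℝ ∞ f) : ContDiff ℝ ∞ (pdt f) := by
  rw [funext (pdt_eq_fderiv hf)]
  exact (hf.fderiv_right (by simp)).clm_apply contDiff_const

theorem pdt_pdx {f : ℝ × ℝ → ℝ} (hf : ContDiff ℝ ∞ f) (p : ℝ × ℝ) :
    pdt (pdx f) p = pdx (pdt f) p := by
  have hd : DifferentiableAt ℝ (fderiv ℝ f) p :=
    (hf.fderiv_right (m := ∞) (by simp)).differentiable (by simp) p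
  have hsymm : IsSymmSndFDerivAt ℝ f p :=
    hf.contDiffAt.isSymmSndFDerivAt (by
      rw [minSmoothness_of_isRCLikeNormedField]
      exact WithTop.coe_le_coe.2 (le_top : (2 : ℕ∞) ≤ ⊤))
  rw [pdt_eq_fderiv (contDiff_pdx hf), pdx_eq_fderiv (contDiff_pdt hf),
    funext (pdx_eq_fderiv hf), funext (pdt_eq_fderiv hf),
    fderiv_clm_apply hd (differentiableAt_const _), fderiv_clm_apply hd (differentiableAt_const _)]
  simpa using hsymm.eq (0, 1) (1, 0)

theorem pdx_mul {f g : ℝ × ℝ → ℝ} (hf : ContDiff ℝ ∞ f) (hg : ContDiff ℝ ∞ g) (p : ℝ × ℝ) :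
    pdx (fun q => f q * g q) p = pdx f p * g p + f p * pdx g p :=
  ((hasDerivAt_pdx hf p).mul (hasDerivAt_pdx hg p)).deriv

theorem pdt_mul {f g : ℝ × ℝ → ℝ} (hf : ContDiff ℝ ∞ f) (hg : ContDiff ℝ ∞ g) (p : ℝ × ℝ) :
    pdt (fun q => f q * g q) p = pdt f p * g p + f p * pdt g p :=
  ((hasDerivAt_pdt hf p).mul (hasDerivAt_pdt hg p)).deriv

theorem pdx_add {f g : ℝ × ℝ → ℝ} (hf : ContDiff ℝ ∞ f) (hg : ContDiff ℝ ∞ g) (p : ℝ × ℝ) :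
    pdx (fun q => f q + g q) p = pdx f p + pdx g p :=
  ((hasDerivAt_pdx hf p).add (hasDerivAt_pdx hg p)).deriv

theorem pdt_add {f g : ℝ × ℝ → ℝ} (hf : ContDiff ℝ ∞ f) (hg : ContDiff ℝ ∞ g) (p : ℝ × ℝ) :
    pdt (fun q => f q + g q) p = pdt f p + pdt g p :=
  ((hasDerivAt_pdt hf p).add (hasDerivAt_pdt hg p)).deriv

theorem pdx_const (c : ℝ) (p : ℝ × ℝ) : pdx (fun _ => c) p = 0 := by simp [pdx]

theorem pdt_const (c : ℝ) (p : ℝ × ℝ) : pdt (fun _ => c) p = 0 := by simp [pdt]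

theorem pdx_comp_pi {ι : Type*} [Fintype ι] {G : (ι → ℝ) → ℝ} (hG : ContDiff ℝ ∞ G)
    {v : ℝ × ℝ → ι → ℝ} (hv : ∀ i, ContDiff ℝ ∞ fun q => v q i) (p : ℝ × ℝ) :
    pdx (fun q => G (v q)) p = fderiv ℝ G (v p) fun i => pdx (fun q => v q i) p :=
  ((hG.differentiable (by simp) (v p)).hasFDerivAt.comp_hasDerivAt (f := fun x => v (x, p.2)) p.1
    (hasDerivAt_pi.2 fun i => hasDerivAt_pdx (hv i) p)).deriv

theorem pdt_comp_pi {ι : Type*} [Fintype ι] {G : (ι → ℝ) → ℝ} (hG : ContDiff ℝ ∞ G)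
    {v : ℝ × ℝ → ι → ℝ} (hv : ∀ i, ContDiff ℝ ∞ fun q => v q i) (p : ℝ × ℝ) :
    pdt (fun q => G (v q)) p = fderiv ℝ G (v p) fun i => pdt (fun q => v q i) p :=
  ((hG.differentiable (by simp) (v p)).hasFDerivAt.comp_hasDerivAt (f := fun t => v (p.1, t)) p.2
    (hasDerivAt_pi.2 fun i => hasDerivAt_pdt (hv i) p)).deriv

/-- The material derivative `∂_t + u ∂_x` along the velocity field `u`. -/
noncomputable def materialDeriv (u f : ℝ × ℝ → ℝ) (p : ℝ × ℝ) : ℝ := pdt f p + u p * pdx f p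

theorem materialDeriv_mul {u f g : ℝ × ℝ → ℝ} (hf : ContDiff ℝ ∞ f) (hg : ContDiff ℝ ∞ g)
    (p : ℝ × ℝ) : materialDeriv u (fun q => f q * g q) p =
      materialDeriv u f p * g p + f p * materialDeriv u g p := by
  simp only [materialDeriv, pdx_mul hf hg, pdt_mul hf hg]
  ring

theorem materialDeriv_add {u f g : ℝ × ℝ → ℝ} (hf : ContDiff ℝ ∞ f) (hg : ContDiff ℝ ∞ g)
    (p : ℝ × ℝ) : materialDeriv u (fun q => f q + g q) p =
      materialDeriv u f p + materialDeriv u g p := by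
  simp only [materialDeriv, pdx_add hf hg, pdt_add hf hg]
  ring

theorem materialDeriv_const (u : ℝ × ℝ → ℝ) (c : ℝ) (p : ℝ × ℝ) :
    materialDeriv u (fun _ => c) p = 0 := by
  simp [materialDeriv, pdx_const, pdt_const]

theorem materialDeriv_pdx {u f : ℝ × ℝ → ℝ} (hu : ContDiff ℝ ∞ u) (hf : ContDiff ℝ ∞ f)
    (p : ℝ × ℝ) :
    materialDeriv u (pdx f) p = pdx (materialDeriv u f) p - pdx u p * pdx f p := by
  have h : pdx (materialDeriv u f) p = pdx (pdt f) p + (pdx u p * pdx f p + u p * pdx (pdx f) p) := by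
    rw [← pdx_mul hu (contDiff_pdx hf)]
    exact pdx_add (contDiff_pdt hf) (hu.mul (contDiff_pdx hf)) p
  rw [h, materialDeriv, pdt_pdx hf]
  ring

theorem materialDeriv_comp_pi {ι : Type*} [Fintype ι] {u : ℝ × ℝ → ℝ} {G : (ι → ℝ) → ℝ}
    (hG : ContDiff ℝ ∞ G) {v : ℝ × ℝ → ι → ℝ} (hv : ∀ i, ContDiff ℝ ∞ fun q => v q i)
    (p : ℝ × ℝ) :
    materialDeriv u (fun q => G (v q)) p =
      fderiv ℝ G (v p) fun i => materialDeriv u (fun q => v q i) p := by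
  rw [materialDeriv, pdx_comp_pi hG hv, pdt_comp_pi hG hv, ← smul_eq_mul, ← map_smul, ← map_add]
  rfl

/-- If `ρ` is transported as a density and the material derivative of `f` is constant, then
`ρ⁻¹ ∂_x f` is constant along the flow. -/
theorem materialDeriv_inv_mul_pdx {u ρ f g : ℝ × ℝ → ℝ} {c : ℝ} (hu : ContDiff ℝ ∞ u)
    (hρ : ContDiff ℝ ∞ ρ) (hf : ContDiff ℝ ∞ f) (hg : ContDiff ℝ ∞ g) (hρ0 : ∀ p, ρ p ≠ 0)
    (hDρ : ∀ p, materialDeriv u ρ p = -(pdx u p * ρ p)) (hDf : ∀ p, materialDeriv u f p = c)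
    (hgf : ∀ p, g p = (ρ p)⁻¹ * pdx f p) (p : ℝ × ℝ) : materialDeriv u g p = 0 := by
  have hfun : pdx f = fun q => ρ q * g q := by
    funext q
    rw [hgf, mul_inv_cancel_left₀ (hρ0 q)]
  have h := materialDeriv_pdx hu hf p
  rw [funext hDf, pdx_const, hfun, materialDeriv_mul hρ hg, hDρ] at h
  exact (mul_eq_zero.1 (by linear_combination h)).resolve_left (hρ0 p)

theorem gurevichZybin_conserved_density (uh Φ : ℝ × ℝ → ℝ)
    (huh : ContDiff ℝ (⊤ : ℕ∞) uh) (hΦ : ContDiff ℝ (⊤ : ℕ∞) Φ)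
    (hequ : ∀ p : ℝ × ℝ, pdt uh p + uh p * pdx uh p + pdx Φ p = 0)
    (heqρ : ∀ p : ℝ × ℝ,
      pdt (fun q => pdx (pdx Φ) q) p + pdx (fun q => uh q * pdx (pdx Φ) q) p = 0)
    (hρ : ∀ p : ℝ × ℝ, pdx (pdx Φ) p ≠ 0)
    (n : ℕ) (hn : 1 ≤ n)
    (G : (Fin (2 * n - 1) → ℝ) → ℝ) (hG : ContDiff ℝ (⊤ : ℕ∞) G)
    (α β : ℕ → ℝ × ℝ → ℝ)
    (hα1 : ∀ p : ℝ × ℝ,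
      α 1 p = ((pdx uh p) ^ 2 + 2 * pdx (pdx Φ) p) * ((pdx (pdx Φ) p) ^ 2)⁻¹)
    (hβ1 : ∀ p : ℝ × ℝ, β 1 p = pdx uh p * (pdx (pdx Φ) p)⁻¹)
    (hαrec : ∀ k, 1 ≤ k → ∀ p : ℝ × ℝ, α (k + 1) p = (pdx (pdx Φ) p)⁻¹ * pdx (α k) p)
    (hβrec : ∀ k, 1 ≤ k → ∀ p : ℝ × ℝ, β (k + 1) p = (pdx (pdx Φ) p)⁻¹ * pdx (β k) p) :
    ∀ p : ℝ × ℝ,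
      pdt (fun q => pdx (pdx Φ) q *
      G (fun i => if i.val = 0 then α 1 q
          else if i.val % 2 = 1 then α (i.val / 2 + 2) q
          else β (i.val / 2 + 1) q)) p
        = pdx (fun q => -(uh q) * ((fun q => pdx (pdx Φ) q *
      G (fun i => if i.val = 0 then α 1 q
          else if i.val % 2 = 1 then α (i.val / 2 + 2) q
          else β (i.val / 2 + 1) q)) q)) p := by
  have hux := contDiff_pdx huh
  have hrs : ContDiff ℝ ∞ (pdx (pdx Φ)) := contDiff_pdx (contDiff_pdx hΦ)
  have hDρ (p) : materialDeriv uh (pdx (pdx Φ)) p = -(pdx uh p * pdx (pdx Φ) p) := by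
    have h := heqρ p
    rw [pdx_mul huh hrs] at h
    rw [materialDeriv]
    linear_combination h
  have hDux (p) : materialDeriv uh (pdx uh) p = -(pdx uh p) ^ 2 - pdx (pdx Φ) p := by
    have hDu : materialDeriv uh uh = fun q => -1 * pdx Φ q := by
      funext q
      rw [materialDeriv]
      linear_combination hequ q
    rw [materialDeriv_pdx huh huh, hDu, pdx_mul contDiff_const (contDiff_pdx hΦ), pdx_const]
    ring
  have hαs : ∀ k, 1 ≤ k → ContDiff ℝ ∞ (α k) := by
    refine Nat.le_induction ?_ fun k hk ih => ?_
    · rw [funext hα1]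
      exact ((hux.pow 2).add (contDiff_const.mul hrs)).mul
        ((hrs.pow 2).inv fun p => pow_ne_zero 2 (hρ p))
    · rw [funext (hαrec k hk)]
      exact (hrs.inv hρ).mul (contDiff_pdx ih)
  have hβs : ∀ k, 1 ≤ k → ContDiff ℝ ∞ (β k) := by
    refine Nat.le_induction ?_ fun k hk ih => ?_
    · rw [funext hβ1]
      exact hux.mul (hrs.inv hρ)
    · rw [funext (hβrec k hk)]
      exact (hrs.inv hρ).mul (contDiff_pdx ih)
  have hDα : ∀ k, 1 ≤ k → ∀ p, materialDeriv uh (α k) p = 0 := by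
    refine Nat.le_induction (fun p => ?_) fun k hk ih =>
      materialDeriv_inv_mul_pdx huh hrs (hαs k hk) (hαs _ (by omega)) hρ hDρ ih (hαrec k hk)
    have hfun : (fun q => pdx (pdx Φ) q * (pdx (pdx Φ) q * α 1 q)) =
        fun q => pdx uh q * pdx uh q + 2 * pdx (pdx Φ) q := by
      funext q
      have := hρ q
      rw [hα1]
      field_simp
    have h := congrArg (fun f => materialDeriv uh f p) hfun
    have h1 := congrFun hfun p
    beta_reduce at h h1
    rw [materialDeriv_mul hrs (hrs.mul (hαs 1 le_rfl)), materialDeriv_mul hrs (hαs 1 le_rfl),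
      materialDeriv_add (hux.mul hux) (contDiff_const.mul hrs), materialDeriv_mul hux hux,
      materialDeriv_mul contDiff_const hrs, materialDeriv_const, hDρ, hDux] at h
    refine (mul_eq_zero.1 ?_).resolve_left (pow_ne_zero 2 (hρ p))
    linear_combination h + 2 * pdx uh p * h1
  have hDβ1 (p) : materialDeriv uh (β 1) p = -1 := by
    have hfun : pdx uh = fun q => pdx (pdx Φ) q * β 1 q := by
      funext q
      have := hρ q
      rw [hβ1]
      field_simp
    have h := congrArg (fun f => materialDeriv uh f p) hfun
    have h1 := congrFun hfun p
    beta_reduce at h h1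
    rw [materialDeriv_mul hrs (hβs 1 le_rfl), hDρ, hDux] at h
    refine mul_left_cancel₀ (hρ p) ?_
    linear_combination -h - pdx uh p * h1
  have hDβ : ∀ k, 2 ≤ k → ∀ p, materialDeriv uh (β k) p = 0 := by
    refine Nat.le_induction ?_ fun k hk ih =>
      materialDeriv_inv_mul_pdx huh hrs (hβs k (by omega)) (hβs _ (by omega)) hρ hDρ ih
        (hβrec k (by omega))
    exact materialDeriv_inv_mul_pdx huh hrs (hβs 1 le_rfl) (hβs 2 (by omega)) hρ hDρ hDβ1
      (hβrec 1 le_rfl)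
  set v : ℝ × ℝ → Fin (2 * n - 1) → ℝ := fun q i =>
    if i.val = 0 then α 1 q
      else if i.val % 2 = 1 then α (i.val / 2 + 2) q
      else β (i.val / 2 + 1) q with hv
  have hvi (i) : ContDiff ℝ ∞ (fun q => v q i) ∧ ∀ p, materialDeriv uh (fun q => v q i) p = 0 := by
    simp only [hv]
    split_ifs with h0 h1
    · exact ⟨hαs 1 le_rfl, hDα 1 le_rfl⟩
    · exact ⟨hαs _ (by omega), hDα _ (by omega)⟩
    · exact ⟨hβs _ (by omega), hDβ _ (by omega)⟩
  have hvs : ContDiff ℝ ∞ v := contDiff_pi.2 fun i => (hvi i).1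
  have hGv : ContDiff ℝ ∞ fun q => G (v q) := hG.comp hvs
  have hDG (p) : materialDeriv uh (fun q => G (v q)) p = 0 := by
    rw [materialDeriv_comp_pi hG fun i => (hvi i).1]
    simp only [fun i => (hvi i).2 p]
    exact map_zero _
  intro p
  have hF : ContDiff ℝ ∞ fun q => pdx (pdx Φ) q * G (v q) := hrs.mul hGv
  have hDF := materialDeriv_mul (u := uh) hrs hGv p
  rw [hDG, hDρ, materialDeriv] at hDF
  have hneg : (fun q => -(uh q) * (pdx (pdx Φ) q * G (v q))) =
      fun q => -1 * (uh q * (pdx (pdx Φ) q * G (v q))) := by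
    funext q
    ring
  change pdt (fun q => pdx (pdx Φ) q * G (v q)) p =
    pdx (fun q => -(uh q) * (pdx (pdx Φ) q * G (v q))) p
  rw [hneg, pdx_mul contDiff_const (huh.mul hF), pdx_const, pdx_mul huh hF]
  linear_combination hDF
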